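/- arXiv:2412.12141 — 2 statements merged into one kernel-verified Lean document; each statement's English description precedes it below -/
import Mathlib

section
/- Let n, m be coprime positive integers. Every ∼-equivalence class in 𝒲 × ℤ has exactly m+n elements. -/
/-- The letter `R` (a rightward step). -/
def Rl : Bool := true

/-- The letter `D` (a downward step). -/
def Dl : Bool := false

/-- A word: a sequence of length `m + n` in the alphabet `{R, D}` with exactly `m`
letters `R` (and hence exactly `n` letters `D`). -/
def IsWord (n m : ℕ) (w : List Bool) : Prop :=
  w.length = m + n ∧ w.count Rl = m

/-- The generating relation for `∼` on `𝒲 × ℤ`: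
`(xD, k) ∼ (Dx, k + m)` and `(Rx, k) ∼ (xR, k + n)` for every string `x` of length
`m + n - 1`. -/
inductive WRel (n m : ℕ) : List Bool × ℤ → List Bool × ℤ → Prop
  | row (x : List Bool) (k : ℤ) (hx : x.length = m + n - 1) :
      WRel n m (x ++ [Dl], k) (Dl :: x, k + m)
  | col (x : List Bool) (k : ℤ) (hx : x.length = m + n - 1) :
      WRel n m (Rl :: x, k) (x ++ [Rl], k + n)

/-- The generating relation for `≈` on `𝒲 × ℤ` (only the row rule):
`(xD, k) ≈ (Dx, k + m)` for every string `x` of length `m + n - 1`. -/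
inductive WRelRow (n m : ℕ) : List Bool × ℤ → List Bool × ℤ → Prop
  | row (x : List Bool) (k : ℤ) (hx : x.length = m + n - 1) :
      WRelRow n m (x ++ [Dl], k) (Dl :: x, k + m)

/-- `w_i`: the word obtained from `w` by moving its first `i` letters (in order) to
the end. -/
def rotWord (w : List Bool) (i : ℕ) : List Bool := w.drop i ++ w.take i

/-- `k_i = k_0 + n·Σ_{j=1}^{i} c_j − m·Σ_{j=1}^{i} d_j`, where `c_j = 1` iff the `j`-th
letter of `w` is `R` and `d_j = 1` iff it is `D` (so the sums are the numbers of `R`'s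
and `D`'s among the first `i` letters of `w`). -/
def rotK (n m : ℕ) (w : List Bool) (k0 : ℤ) (i : ℕ) : ℤ :=
  k0 + (n : ℤ) * ((w.take i).count Rl : ℤ) - (m : ℤ) * ((w.take i).count Dl : ℤ)

/-- Move the first letter of the word to its end, adding `n` to the integer if that letter is `R`
and subtracting `m` if it is `D`. -/
def rotStep (n m : ℕ) : List Bool × ℤ → List Bool × ℤ
  | ([], k) => ([], k)
  | (a :: x, k) => (x ++ [a], if a = Rl then k + n else k - m)

lemma rotStep_injective (n m : ℕ) : Function.Injective (rotStep n m) := by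
  rintro ⟨_ | ⟨a, x⟩, k⟩ ⟨_ | ⟨b, y⟩, l⟩ h
  · exact h
  · simp [rotStep] at h
  · simp [rotStep] at h
  · simp only [rotStep, Prod.mk.injEq] at h
    obtain ⟨h₁, h₂⟩ := h
    obtain ⟨rfl, h₃⟩ := List.append_inj' h₁ rfl
    obtain rfl : a = b := by simpa using h₃
    split_ifs at h₂ <;> simp_all

lemma WRel.rotStep_eq_or {n m : ℕ} {p q : List Bool × ℤ} (h : WRel n m p q) :
    rotStep n m p = q ∨ rotStep n m q = p := by
  cases h with
  | row x k hx => right; simp [rotStep, Rl, Dl]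
  | col x k hx => left; simp [rotStep]

lemma eqvGen_rotStep {n m : ℕ} {p : List Bool × ℤ} (hp : p.1.length = m + n) :
    Relation.EqvGen (WRel n m) p (rotStep n m p) := by
  obtain ⟨_ | ⟨a, x⟩, k⟩ := p
  · exact .refl _
  · have hx : x.length = m + n - 1 := by simp at hp; omega
    cases a with
    | true => exact .rel _ _ (.col x k hx)
    | false =>
      have h := WRel.row (n := n) (m := m) x (k - m) hx
      rw [sub_add_cancel] at h
      exact .symm _ _ (.rel _ _ h)

lemma length_rotWord (w : List Bool) (i : ℕ) : (rotWord w i).length = w.length := by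
  simp only [rotWord, List.length_append, List.length_drop, List.length_take]
  omega

lemma rotStep_rot (n m : ℕ) (w : List Bool) (k : ℤ) {i : ℕ} (hi : i < w.length) :
    rotStep n m (rotWord w i, rotK n m w k i) = (rotWord w (i + 1), rotK n m w k (i + 1)) := by
  have hd : w.drop i = w[i] :: w.drop (i + 1) := List.drop_eq_getElem_cons hi
  have ht : w.take (i + 1) = w.take i ++ [w[i]] := (List.take_append_getElem hi).symm
  simp only [rotWord, rotK, hd, ht, List.cons_append, rotStep, List.append_assoc,
    List.count_append, Prod.mk.injEq, true_and]
  cases w[i] <;> simp [Rl, Dl] <;> ring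

lemma count_take_Rl_add_count_take_Dl {w : List Bool} {i : ℕ} (hi : i ≤ w.length) :
    (w.take i).count Rl + (w.take i).count Dl = i := by
  have h := List.count_true_add_count_false (w.take i)
  rwa [List.length_take, min_eq_left hi] at h

lemma IsWord.count_Dl {n m : ℕ} {w : List Bool} (hw : IsWord n m w) : w.count Dl = n := by
  have h := List.count_true_add_count_false w
  have h₁ := hw.1
  have h₂ := hw.2
  simp only [Rl, Dl] at *
  omega

lemma IsWord.rot_length {n m : ℕ} {w : List Bool} (hw : IsWord n m w) (k : ℤ) :
    (rotWord w (m + n), rotK n m w k (m + n)) = (w, k) := by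
  have h := hw.count_Dl
  obtain ⟨h₁, h₂⟩ := hw
  simp only [rotWord, rotK, ← h₁, List.drop_length, List.take_length, h, h₂, List.nil_append]
  simp [mul_comm]

lemma rot_zero (n m : ℕ) (w : List Bool) (k : ℤ) : (rotWord w 0, rotK n m w k 0) = (w, k) := by
  simp [rotWord, rotK]

lemma eqvGen_rot {n m : ℕ} {w : List Bool} (hw : w.length = m + n) (k : ℤ) {i : ℕ}
    (hi : i ≤ m + n) :
    Relation.EqvGen (WRel n m) (w, k) (rotWord w i, rotK n m w k i) := by
  induction i with
  | zero => rw [rot_zero]; exact .refl _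
  | succ i ih =>
    refine .trans _ _ _ (ih (by omega)) ?_
    rw [← rotStep_rot n m w k (by omega)]
    exact eqvGen_rotStep ((length_rotWord w i).trans hw)

lemma IsWord.rotStep_mem_iff {n m : ℕ} {w : List Bool} (hw : IsWord n m w) (hn : 0 < n) (k : ℤ)
    (p : List Bool × ℤ) :
    (∃ i < m + n, (rotWord w i, rotK n m w k i) = rotStep n m p) ↔
      ∃ i < m + n, (rotWord w i, rotK n m w k i) = p := by
  have hper := (hw.rot_length k).trans (rot_zero n m w k).symm
  constructor
  · rintro ⟨_ | i, hi, h⟩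
    · refine ⟨m + n - 1, by omega, rotStep_injective n m ?_⟩
      rw [rotStep_rot n m w k (by have := hw.1; omega), Nat.sub_add_cancel (by omega), hper, h]
    · refine ⟨i, by omega, rotStep_injective n m ?_⟩
      rw [rotStep_rot n m w k (by have := hw.1; omega), h]
  · rintro ⟨i, hi, rfl⟩
    rw [rotStep_rot n m w k (by have := hw.1; omega)]
    rcases Nat.lt_or_ge (i + 1) (m + n) with h | h
    · exact ⟨i + 1, h, rfl⟩
    · obtain h : i + 1 = m + n := by omega
      exact ⟨0, by omega, by rw [h, hper]⟩

lemma IsWord.mem_rot_iff_of_eqvGen {n m : ℕ} {w : List Bool} (hw : IsWord n m w) (hn : 0 < n)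
    (k : ℤ) {p q : List Bool × ℤ} (h : Relation.EqvGen (WRel n m) p q) :
    (∃ i < m + n, (rotWord w i, rotK n m w k i) = p) ↔
      ∃ i < m + n, (rotWord w i, rotK n m w k i) = q := by
  induction h with
  | rel p q h =>
    rcases h.rotStep_eq_or with rfl | rfl
    · exact (hw.rotStep_mem_iff hn k p).symm
    · exact hw.rotStep_mem_iff hn k q
  | refl => exact Iff.rfl
  | symm _ _ _ ih => exact ih.symm
  | trans _ _ _ _ _ ih₁ ih₂ => exact ih₁.trans ih₂

lemma IsWord.rotK_ne {n m : ℕ} {w : List Bool} (hw : IsWord n m w) (hn : 0 < n)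
    (hco : Nat.Coprime n m) (k : ℤ) {i j : ℕ} (hij : i < j) (hj : j < m + n) :
    rotK n m w k i ≠ rotK n m w k j := by
  intro h
  have hlen := hw.1
  have hi' := count_take_Rl_add_count_take_Dl (w := w) (i := i) (by omega)
  have hj' := count_take_Rl_add_count_take_Dl (w := w) (i := j) (by omega)
  have hR : (w.take i).count Rl ≤ (w.take j).count Rl :=
    (List.take_sublist_take_left hij.le).count_le _
  have hD : (w.take i).count Dl ≤ (w.take j).count Dl :=
    (List.take_sublist_take_left hij.le).count_le _
  have hR' : (w.take j).count Rl ≤ m := hw.2 ▸ (List.take_sublist j w).count_le _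
  have hD' : (w.take j).count Dl ≤ n := hw.count_Dl ▸ (List.take_sublist j w).count_le _
  obtain ⟨c, hc⟩ := Nat.exists_eq_add_of_le hR
  obtain ⟨d, hd⟩ := Nat.exists_eq_add_of_le hD
  have hcd : n * c = m * d := by
    simp only [rotK, hc, hd] at h
    push_cast at h
    zify
    linarith
  obtain ⟨e, rfl⟩ : n ∣ d := hco.dvd_of_dvd_mul_left ⟨c, hcd.symm⟩
  obtain rfl : c = m * e := Nat.eq_of_mul_eq_mul_left hn (by rw [hcd]; ring)
  rcases e with _ | e
  · omega
  · have h₁ : m ≤ m * (e + 1) := Nat.le_mul_of_pos_right m e.succ_pos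
    have h₂ : n ≤ n * (e + 1) := Nat.le_mul_of_pos_right n e.succ_pos
    omega

/-- If `m, n` are coprime, every `∼`-equivalence class in `𝒲 × ℤ` has
exactly `m + n` elements. -/
theorem eqv_class_card (n m : ℕ) (hn : 0 < n) (hm : 0 < m) (hco : Nat.Coprime n m)
    (w : List Bool) (hw : IsWord n m w) (k : ℤ) :
    {p : List Bool × ℤ | Relation.EqvGen (WRel n m) (w, k) p}.ncard = m + n := by
  have hclass : {p : List Bool × ℤ | Relation.EqvGen (WRel n m) (w, k) p} =
      (fun i => (rotWord w i, rotK n m w k i)) '' (Finset.range (m + n) : Set ℕ) := by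
    ext p
    simp only [Set.mem_ofPred_eq, Set.mem_image, Finset.coe_range, Set.mem_Iio]
    constructor
    · intro h
      exact (hw.mem_rot_iff_of_eqvGen hn k h).1 ⟨0, by omega, rot_zero n m w k⟩
    · rintro ⟨i, hi, rfl⟩
      exact eqvGen_rot hw.1 k hi.le
  have hinj : Set.InjOn (fun i => (rotWord w i, rotK n m w k i))
      (Finset.range (m + n) : Set ℕ) := by
    intro i hi j hj h
    simp only [Finset.coe_range, Set.mem_Iio] at hi hj
    have h' : rotK n m w k i = rotK n m w k j := congrArg Prod.snd h
    rcases lt_trichotomy i j with hlt | heq | hgt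
    · exact absurd h' (hw.rotK_ne hn hco k hlt hj)
    · exact heq
    · exact absurd h'.symm (hw.rotK_ne hn hco k hgt hi)
  rw [hclass, hinj.ncard_image, Set.ncard_coe_finset, Finset.card_range]
end

section
/- Let n, m be coprime positive integers and d ∈ ℤ. The set {(λ, k) ∈ X × ℤ : |λ| + k = d} is a union of ∼-equivalence classes, and the number of ∼-equivalence classes it contains equals (1/(m+n))·C(m+n, n), where C(m+n, n) is the binomial coefficient. -/
/-- A Young diagram in the `n × m` rectangle, recorded as its sequence of parts
`λ_1 ≥ λ_2 ≥ … ≥ λ_n` (indexed from `1`), with `λ_i = 0` for `i = 0` and `i > n`. -/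
structure YD (n m : ℕ) where
  part : ℕ → ℕ
  mono : ∀ ⦃i j : ℕ⦄, 1 ≤ i → i ≤ j → part j ≤ part i
  le_m : part 1 ≤ m
  outside : ∀ i, n < i → part i = 0
  at_zero : part 0 = 0

namespace YD

variable {n m : ℕ}

/-- The box `B(ε_i - δ_j)` (row `i` from the top, column `j` from the left)
belongs to the diagram `lam`. -/
def mem (lam : YD n m) (i j : ℕ) : Prop :=
  1 ≤ i ∧ i ≤ n ∧ 1 ≤ j ∧ j ≤ m ∧ j ≤ lam.part (n + 1 - i)

/-- The dual partition: `λ'_j = #{i ∈ {1,…,n} : λ_i ≥ j}`. -/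
def dual (lam : YD n m) (j : ℕ) : ℕ :=
  ((Finset.Icc 1 n).filter (fun i => j ≤ lam.part i)).card

/-- `mu` is obtained from `lam` by adding the box `B(ε_i - δ_j)`. -/
def IsAdd (lam : YD n m) (i j : ℕ) (mu : YD n m) : Prop :=
  ∀ i' j', mu.mem i' j' ↔ (lam.mem i' j' ∨ (i' = i ∧ j' = j))

/-- `mu` is obtained from `lam` by removing the box `B(ε_i - δ_j)`. -/
def IsRemove (lam : YD n m) (i j : ℕ) (mu : YD n m) : Prop :=
  ∀ i' j', mu.mem i' j' ↔ (lam.mem i' j' ∧ ¬(i' = i ∧ j' = j))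

/-- `B(ε_i - δ_j)` is an outer corner of `lam`: it lies in the rectangle, is not a box of
`lam`, and adding it to `lam` yields a Young diagram. -/
def OuterCorner (lam : YD n m) (i j : ℕ) : Prop :=
  1 ≤ i ∧ i ≤ n ∧ 1 ≤ j ∧ j ≤ m ∧ ¬ lam.mem i j ∧ ∃ mu : YD n m, lam.IsAdd i j mu

/-- `B(ε_i - δ_j)` is an inner corner of `lam`: it is a box of `lam` and removing it
from `lam` yields a Young diagram. -/
def InnerCorner (lam : YD n m) (i j : ℕ) : Prop :=
  lam.mem i j ∧ ∃ mu : YD n m, lam.IsRemove i j mu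

/-- `λ^{-r} = (λ_2, …, λ_n, 0)`: delete the bottom (longest) row. -/
def rowDel (lam : YD n m) : YD n m where
  part := fun i => if i = 0 then 0 else lam.part (i + 1)
  mono := by
    intro i j hi hij
    have hi' : i ≠ 0 := by omega
    have hj' : j ≠ 0 := by omega
    simp only [hi', hj', if_neg, ite_false]
    exact lam.mono (by omega) (by omega)
  le_m := by
    simpa using le_trans (lam.mono (by omega) (by omega : (1:ℕ) ≤ 2)) lam.le_m
  outside := by
    intro i hi
    have : i ≠ 0 := by omega
    simp only [this, ite_false]
    exact lam.outside _ (by omega)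
  at_zero := by simp

/-- `λ^{+r} = (m, λ_1, …, λ_{n-1})`: add a full row of length `m` at the bottom. -/
def rowAdd (lam : YD n m) : YD n m where
  part := fun i => if i = 0 ∨ n < i then 0 else if i = 1 then m else lam.part (i - 1)
  mono := by
    intro i j hi hij
    by_cases hj : j = 0 ∨ n < j
    · simp [hj]
    · have hi0 : ¬ (i = 0 ∨ n < i) := by omega
      simp only [hj, hi0, ite_false]
      by_cases hi1 : i = 1
      · subst hi1
        by_cases hj1 : j = 1
        · simp [hj1]
        · simp only [hj1, ite_false]
          exact le_trans (lam.mono (by omega) (by omega : 1 ≤ j - 1)) lam.le_m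
      · have hj1 : j ≠ 1 := by omega
        simp only [hi1, hj1, ite_false]
        exact lam.mono (by omega) (by omega)
  le_m := by
    by_cases hn : n = 0
    · simp [hn]
    · have : ¬ ((1:ℕ) = 0 ∨ n < 1) := by omega
      simp [this, hn]
  outside := by
    intro i hi
    simp [Or.inr hi]
  at_zero := by simp

/-- `λ^{-c} = (λ_1 - 1, …, λ_n - 1)`: delete the first column. -/
def colDel (lam : YD n m) : YD n m where
  part := fun i => lam.part i - 1
  mono := fun _ _ hi hij => Nat.sub_le_sub_right (lam.mono hi hij) 1
  le_m := le_trans (Nat.sub_le _ _) lam.le_m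
  outside := fun i hi => by simp [lam.outside i hi]
  at_zero := by simp [lam.at_zero]

/-- `λ^{+c} = (λ_1 + 1, …, λ_n + 1)`: add a full column of height `n` on the left.
(When `λ_1 = m` this clamps at `m`; the operation is only ever used when `λ_1 < m`,
where the clamping is vacuous.) -/
def colAdd (lam : YD n m) : YD n m where
  part := fun i => if i = 0 ∨ n < i then 0 else min m (lam.part i + 1)
  mono := by
    intro i j hi hij
    by_cases hj : j = 0 ∨ n < j
    · simp [hj]
    · have hi0 : ¬ (i = 0 ∨ n < i) := by omega
      simp only [hj, hi0, ite_false]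
      exact min_le_min le_rfl (by exact Nat.succ_le_succ (lam.mono (by omega) hij))
  le_m := by
    by_cases hn : n = 0
    · simp [hn]
    · have : ¬ ((1:ℕ) = 0 ∨ n < 1) := by omega
      simp [this, hn]
  outside := by intro i hi; simp [Or.inr hi]
  at_zero := by simp

end YD

/-- The generating relation for `∼` on `X × ℤ`:
`(λ, k) ∼ (λ^{-r}, k + m)` whenever `λ_1 = m`, and `(λ, k) ∼ (λ^{-c}, k + n)` whenever
`λ_n ≥ 1`. -/
inductive XRel (n m : ℕ) : YD n m × ℤ → YD n m × ℤ → Prop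
  | row (lam : YD n m) (k : ℤ) (h : lam.part 1 = m) :
      XRel n m (lam, k) (lam.rowDel, k + m)
  | col (lam : YD n m) (k : ℤ) (h : 1 ≤ lam.part n) :
      XRel n m (lam, k) (lam.colDel, k + n)

namespace YD

variable {n m : ℕ}

@[ext]
theorem ext_part {lam mu : YD n m} (h : ∀ i, 1 ≤ i → i ≤ n → lam.part i = mu.part i) :
    lam = mu := by
  have : lam.part = mu.part := by
    funext i
    rcases Nat.eq_zero_or_pos i with rfl | hi
    · rw [lam.at_zero, mu.at_zero]
    · by_cases hin : i ≤ n
      · exact h i hi hin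
      · rw [lam.outside i (by omega), mu.outside i (by omega)]
  cases lam
  cases mu
  cases this
  rfl

/-- The position, counted from the row `λ_n`, of the `a`-th vertical step of the boundary path. -/
def bead (lam : YD n m) (a : ℕ) : ℕ := lam.part (n - a) + a

theorem bead_lt_bead (lam : YD n m) {a b : ℕ} (hab : a < b) (hb : b < n) :
    lam.bead a < lam.bead b := by
  have := lam.mono (i := n - b) (j := n - a) (by omega) (by omega)
  unfold bead
  omega

theorem bead_lt (lam : YD n m) {a : ℕ} (ha : a < n) : lam.bead a < m + n := by
  have := lam.mono (i := 1) (j := n - a) le_rfl (by omega)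
  have := lam.le_m
  unfold bead
  omega

/-- The positions of the vertical steps of the boundary path, as residues modulo `m + n`. -/
def beadSet (lam : YD n m) : Finset (ZMod (m + n)) :=
  (Finset.range n).image fun a => (lam.bead a : ZMod (m + n))

theorem mem_beadSet {lam : YD n m} {x : ZMod (m + n)} :
    x ∈ lam.beadSet ↔ ∃ a < n, (lam.bead a : ZMod (m + n)) = x := by
  simp [beadSet]

theorem card_beadSet (lam : YD n m) : lam.beadSet.card = n := by
  rw [beadSet, Finset.card_image_of_injOn, Finset.card_range]
  intro a ha b hb hab
  simp only [Finset.coe_range, Set.mem_Iio] at ha hb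
  simp only [ZMod.natCast_eq_natCast_iff', Nat.mod_eq_of_lt (lam.bead_lt ha),
    Nat.mod_eq_of_lt (lam.bead_lt hb)] at hab
  rcases lt_trichotomy a b with h | h | h
  · have := lam.bead_lt_bead h hb
    omega
  · exact h
  · have := lam.bead_lt_bead h ha
    omega

theorem range_bead (lam : YD n m) :
    Set.range (fun a : Fin n => lam.bead a) =
      {x | x < m + n ∧ (x : ZMod (m + n)) ∈ lam.beadSet} := by
  ext x
  simp only [Set.mem_range, Set.mem_ofPred_eq, mem_beadSet]
  constructor
  · rintro ⟨a, rfl⟩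
    exact ⟨lam.bead_lt a.2, a, a.2, rfl⟩
  · rintro ⟨hx, a, ha, h⟩
    rw [ZMod.natCast_eq_natCast_iff', Nat.mod_eq_of_lt (lam.bead_lt ha),
      Nat.mod_eq_of_lt hx] at h
    exact ⟨⟨a, ha⟩, h⟩

theorem beadSet_injective : Function.Injective (beadSet : YD n m → Finset (ZMod (m + n))) := by
  intro lam mu h
  have hmono (nu : YD n m) : StrictMono fun a : Fin n => nu.bead a :=
    fun a b hab => nu.bead_lt_bead hab b.2
  have hbead := ((hmono lam).range_inj (hmono mu)).1 (by rw [range_bead, range_bead, h])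
  ext i hi hin
  have := congrFun hbead ⟨n - i, by omega⟩
  simpa [bead, Nat.sub_sub_self hin] using this

theorem exists_beadSet_eq [NeZero (m + n)] {S : Finset (ZMod (m + n))} (hS : S.card = n) :
    ∃ lam : YD n m, lam.beadSet = S := by
  have hT : (S.image ZMod.val).card = n := by
    rw [Finset.card_image_of_injective _ (ZMod.val_injective _), hS]
  let f := (S.image ZMod.val).orderEmbOfFin hT
  have hf (a : Fin n) : f a ∈ S.image ZMod.val := Finset.orderEmbOfFin_mem _ hT a
  let t : ℕ → ℕ := fun a => if h : a < n then f ⟨a, h⟩ else 0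
  have ht {a : ℕ} (h : a < n) : t a = f ⟨a, h⟩ := dif_pos h
  have hlt {a : ℕ} (h : a < n) : t a < m + n := by
    obtain ⟨x, -, hx⟩ := Finset.mem_image.1 (hf ⟨a, h⟩)
    rw [ht h, ← hx]
    exact ZMod.val_lt x
  have hgap (a c : ℕ) (h : a + c < n) : t a + c ≤ t (a + c) := by
    induction c with
    | zero => simp
    | succ c ih =>
      have h1 := ih (by omega)
      have h2 : t (a + c) < t (a + (c + 1)) := by
        rw [ht (by omega), ht h]
        exact f.strictMono (Fin.mk_lt_mk.2 (by omega))
      omega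
  let lam : YD n m :=
    { part := fun i => if i = 0 ∨ n < i then 0 else t (n - i) - (n - i)
      mono := by
        intro i j hi hij
        by_cases hj : n < j
        · simp [hj]
        · rw [if_neg (by omega), if_neg (by omega)]
          have := hgap (n - j) (j - i) (by omega)
          rw [show n - j + (j - i) = n - i by omega] at this
          omega
      le_m := by
        by_cases h : n < 1
        · simp [h]
        · rw [if_neg (by omega)]
          have := hlt (a := n - 1) (by omega)
          omega
      outside := fun i hi => if_pos (Or.inr hi)
      at_zero := if_pos (Or.inl rfl) }
  have hlam {a : ℕ} (ha : a < n) : lam.bead a = t a := by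
    have h := hgap 0 a (by omega)
    have h' : lam.part (n - a) = t (n - (n - a)) - (n - (n - a)) := if_neg (by omega)
    rw [Nat.sub_sub_self ha.le] at h'
    rw [zero_add] at h
    unfold bead
    omega
  refine ⟨lam, Finset.eq_of_subset_of_card_le ?_ (by rw [hS, card_beadSet])⟩
  intro x hx
  obtain ⟨a, ha, rfl⟩ := mem_beadSet.1 hx
  obtain ⟨y, hy, hya⟩ := Finset.mem_image.1 (hf ⟨a, ha⟩)
  rwa [hlam ha, ht ha, ← hya, ZMod.natCast_zmod_val]

/-- Young diagrams in the `n × m` rectangle correspond to `n`-element subsets of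
`ZMod (m + n)`. -/
noncomputable def beadEquiv [NeZero (m + n)] :
    YD n m ≃ {S : Finset (ZMod (m + n)) // S.card = n} :=
  Equiv.ofBijective (fun lam => ⟨lam.beadSet, lam.card_beadSet⟩)
    ⟨fun _ _ h => beadSet_injective (congrArg Subtype.val h),
      fun S => (exists_beadSet_eq S.2).imp fun _ h => Subtype.ext h⟩

theorem beadSet_rowDel (hn : 0 < n) {lam : YD n m} (h : lam.part 1 = m) :
    lam.rowDel.beadSet = lam.beadSet.image (· + 1) := by
  symm
  refine Finset.eq_of_subset_of_card_le ?_ ?_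
  · intro x hx
    obtain ⟨y, hy, rfl⟩ := Finset.mem_image.1 hx
    obtain ⟨a, ha, rfl⟩ := mem_beadSet.1 hy
    rw [mem_beadSet]
    by_cases han : a + 1 = n
    · refine ⟨0, hn, ?_⟩
      have h0 : lam.part (n + 1) = 0 := lam.outside _ (by omega)
      have h1 : n - a = 1 := by omega
      have h2 : (lam.bead a + 1 : ℕ) = m + n := by
        rw [bead, h1, h]
        omega
      have h3 : lam.rowDel.bead 0 = 0 := by simp [bead, rowDel, h0]
      rw [h3, ← Nat.cast_one, ← Nat.cast_add, h2, ZMod.natCast_self, Nat.cast_zero]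
    · refine ⟨a + 1, by omega, ?_⟩
      have h1 : n - (a + 1) ≠ 0 := by omega
      have h2 : n - (a + 1) + 1 = n - a := by omega
      simp [bead, rowDel, h1, h2, add_assoc]
  · rw [Finset.card_image_of_injective _ (add_left_injective _), card_beadSet, card_beadSet]

theorem beadSet_colDel {lam : YD n m} (h : 1 ≤ lam.part n) :
    lam.beadSet = lam.colDel.beadSet.image (· + 1) := by
  rw [beadSet, beadSet, Finset.image_image]
  refine Finset.image_congr fun a ha => ?_
  have ha' : a < n := by simpa using ha
  have h1 : 1 ≤ lam.part (n - a) := h.trans (lam.mono (by omega) (by omega))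
  have h2 : lam.bead a = lam.colDel.bead a + 1 := by
    simp only [bead, colDel]
    omega
  simp [h2]

/-- The number of boxes. -/
def size (lam : YD n m) : ℕ := ∑ i ∈ Finset.Icc 1 n, lam.part i

theorem size_rowDel {lam : YD n m} (h : lam.part 1 = m) :
    lam.size = lam.rowDel.size + m := by
  have h1 : lam.size = ∑ a ∈ Finset.range n, lam.part (a + 1) := by
    rw [size, Finset.range_eq_Ico, Finset.sum_Ico_add' lam.part 0 n 1]
    rfl
  have h2 : lam.rowDel.size = ∑ a ∈ Finset.range n, lam.part (a + 1 + 1) := by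
    rw [size, Finset.range_eq_Ico, Finset.sum_Ico_add' (fun a => lam.part (a + 1)) 0 n 1]
    refine Finset.sum_congr rfl fun i hi => if_neg ?_
    have := Finset.mem_Icc.1 hi
    omega
  have h3 := Finset.sum_range_succ (fun a => lam.part (a + 1)) n
  rw [Finset.sum_range_succ', zero_add, h, lam.outside (n + 1) (by omega)] at h3
  omega

theorem size_colDel {lam : YD n m} (h : 1 ≤ lam.part n) :
    lam.size = lam.colDel.size + n := by
  have h1 : ∀ i ∈ Finset.Icc 1 n, lam.part i = lam.colDel.part i + 1 := by
    intro i hi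
    rw [Finset.mem_Icc] at hi
    have := lam.mono hi.1 hi.2
    simp only [colDel]
    omega
  rw [size, Finset.sum_congr rfl h1, Finset.sum_add_distrib]
  simp [size]

end YD

theorem Finset.image_add_image_add {G : Type*} [AddSemigroup G] [DecidableEq G] (S : Finset G)
    (a b : G) : (S.image (· + a)).image (· + b) = S.image (· + (a + b)) := by
  simp only [Finset.image_image, Function.comp_def, add_assoc]

namespace XRel

variable {n m : ℕ}

theorem degree_eq {p q : YD n m × ℤ} (h : XRel n m p q) :
    (p.1.size : ℤ) + p.2 = q.1.size + q.2 := by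
  cases h with
  | row lam k h =>
    have := YD.size_rowDel h
    dsimp only
    omega
  | col lam k h =>
    have := YD.size_colDel h
    dsimp only
    omega

theorem degree_eq_of_eqvGen {p q : YD n m × ℤ}
    (h : Relation.EqvGen (XRel n m) p q) : (p.1.size : ℤ) + p.2 = q.1.size + q.2 := by
  induction h with
  | rel _ _ h => exact h.degree_eq
  | refl => rfl
  | symm _ _ _ ih => exact ih.symm
  | trans _ _ _ _ _ ih₁ ih₂ => exact ih₁.trans ih₂

theorem exists_beadSet_eq_image_of_eqvGen (hn : 0 < n) {p q : YD n m × ℤ}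
    (h : Relation.EqvGen (XRel n m) p q) :
    ∃ c : ZMod (m + n), q.1.beadSet = p.1.beadSet.image (· + c) := by
  have hsymm {S T : Finset (ZMod (m + n))} {c : ZMod (m + n)} (h : T = S.image (· + c)) :
      S = T.image (· + -c) := by
    rw [h, Finset.image_add_image_add, add_neg_cancel]
    simp
  induction h with
  | rel _ _ h =>
    cases h with
    | row lam k h => exact ⟨1, YD.beadSet_rowDel hn h⟩
    | col lam k h => exact ⟨-1, hsymm (YD.beadSet_colDel h)⟩
  | refl => exact ⟨0, by simp⟩
  | symm _ _ _ ih =>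
    obtain ⟨c, hc⟩ := ih
    exact ⟨-c, hsymm hc⟩
  | trans _ _ _ _ _ ih₁ ih₂ =>
    obtain ⟨c, hc⟩ := ih₁
    obtain ⟨e, he⟩ := ih₂
    exact ⟨c + e, by rw [he, hc, Finset.image_add_image_add]⟩

theorem exists_eqvGen_beadSet_add_one (hn : 0 < n) (p : YD n m × ℤ) :
    ∃ q : YD n m × ℤ, Relation.EqvGen (XRel n m) p q ∧
      q.1.beadSet = p.1.beadSet.image (· + 1) := by
  obtain ⟨lam, k⟩ := p
  by_cases h : lam.part 1 = m
  · exact ⟨_, .rel _ _ (.row lam k h), YD.beadSet_rowDel hn h⟩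
  · have hlt {i : ℕ} (hi : 1 ≤ i) : lam.part i < m :=
      (lam.mono le_rfl hi).trans_lt (lt_of_le_of_ne lam.le_m h)
    have hpart {i : ℕ} (hi : 1 ≤ i) (hin : i ≤ n) : lam.colAdd.part i = lam.part i + 1 := by
      have := hlt hi
      simp only [YD.colAdd]
      rw [if_neg (by omega)]
      omega
    have hpos : 1 ≤ lam.colAdd.part n := by
      rw [hpart hn le_rfl]
      omega
    have hdel : lam.colAdd.colDel = lam := by
      ext i hi hin
      simp [YD.colDel, hpart hi hin]
    refine ⟨(lam.colAdd, k - n), .symm _ _ (.rel _ _ ?_), ?_⟩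
    · simpa [hdel] using XRel.col lam.colAdd (k - n) hpos
    · simpa [hdel] using YD.beadSet_colDel hpos

theorem exists_eqvGen_beadSet_add [NeZero (m + n)] (hn : 0 < n) (p : YD n m × ℤ)
    (c : ZMod (m + n)) :
    ∃ q : YD n m × ℤ, Relation.EqvGen (XRel n m) p q ∧
      q.1.beadSet = p.1.beadSet.image (· + c) := by
  rw [← ZMod.natCast_zmod_val c]
  induction c.val with
  | zero => exact ⟨p, .refl _, by simp⟩
  | succ a ih =>
    obtain ⟨q, hpq, hq⟩ := ih
    obtain ⟨r, hqr, hr⟩ := exists_eqvGen_beadSet_add_one hn q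
    exact ⟨r, .trans _ _ _ hpq hqr,
      by rw [hr, hq, Finset.image_add_image_add, Nat.cast_succ]⟩

end XRel

/-- Translation acts freely on finite sets whose cardinality is invertible modulo `N`. -/
theorem ZMod.image_add_injective {N : ℕ} {S : Finset (ZMod N)} (hS : Nat.Coprime S.card N) :
    Function.Injective fun c : ZMod N => S.image (· + c) := by
  intro c e h
  have hsum (x : ZMod N) : ∑ y ∈ S.image (· + x), y = ∑ y ∈ S, y + S.card * x := by
    rw [Finset.sum_image fun a _ b _ hab => add_left_injective x hab]
    simp [Finset.sum_add_distrib]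
  have h' := (hsum c).symm.trans ((congrArg (fun T => ∑ y ∈ T, y) h).trans (hsum e))
  exact ((ZMod.isUnit_iff_coprime _ _).2 hS).mul_left_cancel (add_left_cancel h')

theorem Set.ncard_range_mul_of_card_fiber {α β : Type*} [Finite α] (g : α → β) (N : ℕ)
    (h : ∀ a, Nat.card {b // g b = g a} = N) : (Set.range g).ncard * N = Nat.card α := by
  classical
  have := Fintype.ofFinite α
  rw [Nat.card_congr (Equiv.sigmaFiberEquiv (Set.rangeFactorization g)).symm, Nat.card_sigma,
    Finset.sum_congr rfl (g := fun _ => N), Finset.sum_const, smul_eq_mul, Finset.card_univ,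
    ← Nat.card_eq_fintype_card, Nat.card_coe_set_eq]
  rintro ⟨_, a, rfl⟩ -
  rw [← h a]
  exact Nat.card_congr (Equiv.subtypeEquivRight fun b => Subtype.ext_iff)

/-- Subsection 3.4 of the paper. For coprime `m, n` and any `d ∈ ℤ`,
the set `(X × ℤ)_d = {(λ, k) : |λ| + k = d}` is a union of `∼`-equivalence classes, and
the number of classes it contains is `(1/(m+n))·C(m+n, n)`, i.e. `m + n` times that
number equals the binomial coefficient `C(m+n, n)`. -/
theorem degree_classes_count (n m : ℕ) (hn : 0 < n) (hm : 0 < m)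
    (hco : Nat.Coprime n m) (d : ℤ) :
    (∀ p : YD n m × ℤ,
        ((∑ i ∈ Finset.Icc 1 n, p.1.part i : ℤ) + p.2 = d) →
        ∀ q : YD n m × ℤ, Relation.EqvGen (XRel n m) p q →
        ((∑ i ∈ Finset.Icc 1 n, q.1.part i : ℤ) + q.2 = d)) ∧
    {S : Set (YD n m × ℤ) |
        ∃ p : YD n m × ℤ, ((∑ i ∈ Finset.Icc 1 n, p.1.part i : ℤ) + p.2 = d) ∧
          S = {q | Relation.EqvGen (XRel n m) p q}}.ncard * (m + n) =
      (m + n).choose n := by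
  have hdeg (p : YD n m × ℤ) :
      (∑ i ∈ Finset.Icc 1 n, p.1.part i : ℤ) + p.2 = p.1.size + p.2 := by
    simp [YD.size]
  simp only [hdeg]
  refine ⟨fun p hp q hpq => (XRel.degree_eq_of_eqvGen hpq).symm.trans hp, ?_⟩
  have : NeZero (m + n) := ⟨by omega⟩
  have : Finite (YD n m) := .of_equiv _ YD.beadEquiv.symm
  let g : YD n m → Set (YD n m × ℤ) := fun lam =>
    {q | Relation.EqvGen (XRel n m) (lam, d - lam.size) q}
  have hg (lam mu : YD n m) : g mu = g lam ↔
      Relation.EqvGen (XRel n m) (lam, d - lam.size) (mu, d - mu.size) := by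
    refine ⟨fun h => ?_, fun h => Set.ext fun q => ⟨h.trans _ _ _, (h.symm _ _).trans _ _ _⟩⟩
    have hmem : (mu, d - (mu.size : ℤ)) ∈ g mu := .refl _
    rwa [h] at hmem
  have hrange : {S : Set (YD n m × ℤ) | ∃ p : YD n m × ℤ, (p.1.size : ℤ) + p.2 = d ∧
      S = {q | Relation.EqvGen (XRel n m) p q}} = Set.range g := by
    ext S
    constructor
    · rintro ⟨⟨lam, k⟩, hk, rfl⟩
      obtain rfl : k = d - lam.size := eq_sub_of_add_eq' hk
      exact ⟨lam, rfl⟩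
    · rintro ⟨lam, rfl⟩
      exact ⟨(lam, d - lam.size), by simp, rfl⟩
  have hfiber (lam : YD n m) : Nat.card {mu // g mu = g lam} = m + n := by
    have hex (c : ZMod (m + n)) :
        ∃ mu : {mu // g mu = g lam}, mu.1.beadSet = lam.beadSet.image (· + c) := by
      obtain ⟨⟨mu, k⟩, h, hmu⟩ := XRel.exists_eqvGen_beadSet_add hn (lam, d - lam.size) c
      have hk := XRel.degree_eq_of_eqvGen h
      obtain rfl : k = d - mu.size := by
        dsimp only at hk
        omega
      exact ⟨⟨mu, (hg _ _).2 h⟩, hmu⟩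
    choose f hf using hex
    have hcard : Nat.Coprime lam.beadSet.card (m + n) := by
      simpa [YD.card_beadSet] using hco
    have hbij : Function.Bijective f := by
      refine ⟨fun c e h => ZMod.image_add_injective hcard ?_, fun mu => ?_⟩
      · dsimp only
        rw [← hf, ← hf, h]
      · obtain ⟨c, hc⟩ := XRel.exists_beadSet_eq_image_of_eqvGen hn ((hg _ _).1 mu.2)
        exact ⟨c, Subtype.ext (YD.beadSet_injective ((hf c).trans hc.symm))⟩
    rw [← Nat.card_congr (Equiv.ofBijective f hbij), Nat.card_zmod]
  rw [hrange, Set.ncard_range_mul_of_card_fiber g _ hfiber, Nat.card_congr YD.beadEquiv,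
    Nat.card_eq_fintype_card, Fintype.card_finset_len, ZMod.card]
end
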